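/- arXiv:1802.00307 — 2 statements merged into one kernel-verified Lean document; each statement's English description precedes it below -/
import Mathlib

section
/- Let R ≅ S ×_k T be a non-trivial fiber product of local rings (S, m_S, k) and (T, m_T, k). If dim(S) ≥ dim(T) and R has finite Cohen-Macaulay type, then S has finite Cohen-Macaulay type. -/
/-! Common definitions for formalizing Nasseh–Sather-Wagstaff–Takahashi–VandeBogert,
"Applications and homological properties of local rings with decomposable maximal ideals". -/

open CategoryTheory IsLocalRing

noncomputable section

universe u

/-- The Ext module `Ext^i_R(M, N)`. -/
def extGrp (R : Type u) [CommRing R] (i : ℕ)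
    (M N : Type u) [AddCommGroup M] [Module R M] [AddCommGroup N] [Module R N] :
    ModuleCat.{u} R :=
  ((Ext R (ModuleCat.{u} R) i).obj (Opposite.op (ModuleCat.of R M))).obj (ModuleCat.of R N)

/-- The depth of a module over a local ring:
`depth_R M = inf { i | Ext^i_R(k, M) ≠ 0 }`. -/
def moduleDepth (R : Type u) [CommRing R] [IsLocalRing R]
    (M : Type u) [AddCommGroup M] [Module R M] : ℕ∞ :=
  sInf {n : ℕ∞ | ∃ i : ℕ, n = (i : ℕ∞) ∧
    ¬ Subsingleton (extGrp R i (ResidueField R) M)}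

/-- The length of a module, i.e. the Krull dimension of its lattice of submodules. -/
def moduleLength (R : Type u) [CommRing R]
    (M : Type u) [AddCommGroup M] [Module R M] : WithBot ℕ∞ :=
  Order.krullDim (Submodule R M)

/-- A local ring is Cohen-Macaulay when its depth equals its Krull dimension. -/
def IsCohenMacaulayLocal (R : Type u) [CommRing R] [IsLocalRing R] : Prop :=
  (moduleDepth R R : WithBot ℕ∞) = ringKrullDim R

/-- `HasType R r` means the (Cohen-Macaulay) type of `R` is
`r(R) = dim_k Ext^{depth R}_R(k, R)`; the `k`-dimension is recorded as the length
of this `R`-module (which is annihilated by the maximal ideal). -/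
def HasType (R : Type u) [CommRing R] [IsLocalRing R] (r : ℕ) : Prop :=
  ∃ d : ℕ, moduleDepth R R = (d : ℕ∞) ∧
    moduleLength R (extGrp R d (ResidueField R) R) = (r : ℕ∞)

/-- The minimal number of generators of an ideal. -/
def minGens {R : Type u} [CommRing R] (I : Ideal R) : ℕ :=
  sInf {n : ℕ | ∃ s : Finset R, s.card = n ∧ Ideal.span (s : Set R) = I}

/-- `HasEcodepth R c` means the embedding codepth of `R`, namely
`β₀(m_R) - depth R`, equals `c`. -/
def HasEcodepth (R : Type u) [CommRing R] [IsLocalRing R] (c : ℕ) : Prop :=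
  ∃ d : ℕ, moduleDepth R R = (d : ℕ∞) ∧ minGens (maximalIdeal R) = c + d

/-- A local ring is a hypersurface iff its embedding codepth is at most 1. -/
def IsHypersurfaceLocal (R : Type u) [CommRing R] [IsLocalRing R] : Prop :=
  ∃ d : ℕ, moduleDepth R R = (d : ℕ∞) ∧ minGens (maximalIdeal R) ≤ d + 1

/-- A regular local ring: the maximal ideal is generated by `dim R` elements. -/
def IsRegularLocal (R : Type u) [CommRing R] [IsLocalRing R] : Prop :=
  ∃ d : ℕ, ringKrullDim R = (d : WithBot ℕ∞) ∧ minGens (maximalIdeal R) = d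

/-- `IsHSMultAt R I e`: the Hilbert–Samuel multiplicity of `R` with respect to the
ideal `I` is the positive integer `e`, i.e. `d! * length(R/I^{n+1}) / n^d → e`
where `d = dim R`. -/
def IsHSMultAt (R : Type u) [CommRing R] (I : Ideal R) (e : ℕ) : Prop :=
  0 < e ∧ ∃ (d : ℕ) (h : ℕ → ℕ), ringKrullDim R = (d : WithBot ℕ∞) ∧
    (∀ n : ℕ, moduleLength R (R ⧸ I ^ (n + 1)) = ((h n : ℕ∞) : WithBot ℕ∞)) ∧
    Filter.Tendsto (fun n : ℕ => ((Nat.factorial d * h n : ℕ) : ℝ) / (n : ℝ) ^ d)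
      Filter.atTop (nhds (e : ℝ))

/-- `IsHSMult R e`: the Hilbert–Samuel multiplicity `e(R)` of the local ring `R` is `e`. -/
def IsHSMult (R : Type u) [CommRing R] [IsLocalRing R] (e : ℕ) : Prop :=
  IsHSMultAt R (maximalIdeal R) e

/-- The maximal ideal of `R` is decomposable: `m_R = I ⊕ J` with `I, J ≠ 0`. -/
def HasDecomposableMaxIdeal (R : Type u) [CommRing R] [IsLocalRing R] : Prop :=
  ∃ I J : Ideal R, I ≠ ⊥ ∧ J ≠ ⊥ ∧ I ⊓ J = ⊥ ∧ I ⊔ J = maximalIdeal R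

/-- Auslander's condition (AC). -/
def SatisfiesAC (R : Type u) [CommRing R] : Prop :=
  ∀ (M : Type u) [AddCommGroup M] [Module R M], Module.Finite R M →
    ∃ b : ℕ, ∀ (N : Type u) [AddCommGroup N] [Module R N], Module.Finite R N →
      (∃ i₀ : ℕ, ∀ i ≥ i₀, Subsingleton (extGrp R i M N)) →
      ∀ i > b, Subsingleton (extGrp R i M N)

/-- The uniform Auslander condition (UAC). -/
def SatisfiesUAC (R : Type u) [CommRing R] : Prop :=
  ∃ b : ℕ, ∀ (M : Type u) [AddCommGroup M] [Module R M], Module.Finite R M →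
    ∀ (N : Type u) [AddCommGroup N] [Module R N], Module.Finite R N →
      (∃ i₀ : ℕ, ∀ i ≥ i₀, Subsingleton (extGrp R i M N)) →
      ∀ i > b, Subsingleton (extGrp R i M N)

/-- A finitely generated module `C` is semidualizing if the homothety map
`R → Hom_R(C,C)` is bijective and `Ext^i_R(C,C) = 0` for all `i ≥ 1`. -/
def IsSemidualizing (R : Type u) [CommRing R]
    (C : Type u) [AddCommGroup C] [Module R C] : Prop :=
  Module.Finite R C ∧ Function.Bijective ⇑(LinearMap.lsmul R C) ∧
    ∀ i : ℕ, 1 ≤ i → Subsingleton (extGrp R i C C)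

/-- A module has finite injective dimension iff some `n` bounds the degrees of all
nonvanishing `Ext^i_R(-, C)`. -/
def HasFiniteInjDim (R : Type u) [CommRing R]
    (C : Type u) [AddCommGroup C] [Module R C] : Prop :=
  ∃ n : ℕ, ∀ (M : Type u) [AddCommGroup M] [Module R M],
    ∀ i > n, Subsingleton (extGrp R i M C)

/-- A dualizing module is a semidualizing module of finite injective dimension. -/
def IsDualizingModule (R : Type u) [CommRing R]
    (C : Type u) [AddCommGroup C] [Module R C] : Prop :=
  IsSemidualizing R C ∧ HasFiniteInjDim R C

/-- A local ring is Gorenstein iff it has finite injective dimension over itself. -/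
def IsGorensteinLocal (R : Type u) [CommRing R] [IsLocalRing R] : Prop :=
  HasFiniteInjDim R R

/-- An indecomposable module. -/
def IsIndecomposableMod (R : Type u) [CommRing R]
    (M : Type u) [AddCommGroup M] [Module R M] : Prop :=
  ¬ Subsingleton M ∧ ∀ N₁ N₂ : Submodule R M, IsCompl N₁ N₂ → N₁ = ⊥ ∨ N₂ = ⊥

/-- A maximal Cohen-Macaulay module: `depth_R M = dim R`. -/
def IsMCM (R : Type u) [CommRing R] [IsLocalRing R]
    (M : Type u) [AddCommGroup M] [Module R M] : Prop :=
  Module.Finite R M ∧ (moduleDepth R M : WithBot ℕ∞) = ringKrullDim R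

/-- A local ring has finite Cohen-Macaulay type if there are only finitely many
isomorphism classes of indecomposable maximal Cohen-Macaulay modules. -/
def HasFiniteCMType (R : Type u) [CommRing R] [IsLocalRing R] : Prop :=
  ∃ L : List (ModuleCat.{u} R), ∀ M : ModuleCat.{u} R,
    IsMCM R M → IsIndecomposableMod R M → ∃ N ∈ L, Nonempty (M ≅ N)

/-- A local ring is analytically unramified if its completion is reduced. -/
def IsAnalyticallyUnramified (R : Type u) [CommRing R] [IsLocalRing R] : Prop :=
  IsReduced (AdicCompletion (maximalIdeal R) R)

/-- `R` is (isomorphic to) the completion of a local ring essentially of finite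
type over `k`. -/
def IsCompletionOfEssFiniteType (k : Type u) [Field k] (R : Type u) [CommRing R]
    [Algebra k R] : Prop :=
  ∃ (A : Type u) (_ : CommRing A) (_ : IsLocalRing A) (_ : Algebra k A),
    Algebra.EssFiniteType k A ∧
      Nonempty (R ≃+* AdicCompletion (maximalIdeal A) A)

/-- The fiber product `S ×_k T` of two local rings along surjections onto their
common residue field `k`, realized as a subring of `S × T`. -/
def fiberProduct {S T k : Type u} [CommRing S] [CommRing T] [CommRing k]
    (πS : S →+* k) (πT : T →+* k) : Subring (S × T) :=
  RingHom.eqLocus (πS.comp (RingHom.fst S T)) (πT.comp (RingHom.snd S T))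

/-- The data making `πS, πT` a (non-trivial) fiber product diagram of local rings
over their common residue field `k`. -/
def IsResidueSurjection {A k : Type u} [CommRing A] [IsLocalRing A] [Field k]
    (π : A →+* k) : Prop :=
  Function.Surjective π ∧ RingHom.ker π = maximalIdeal A

/-- `k` is algebraic over a finite field. -/
def IsAlgebraicOverFiniteField (k : Type u) [Field k] : Prop :=
  ∃ F : Subfield k, (F : Set k).Finite ∧
    ∀ x : k, ∃ f : Polynomial ↥F, f ≠ 0 ∧ Polynomial.eval₂ F.subtype x f = 0

end
/-- The canonical surjection `S ×_k T → S`. -/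
def fpToS {k S T : Type} [CommRing S] [CommRing T] [CommRing k]
    (πS : S →+* k) (πT : T →+* k) : ↥(fiberProduct πS πT) →+* S :=
  (RingHom.fst S T).comp (fiberProduct πS πT).subtype

/-- Indecomposability of `M` as an `A`-module via restriction of scalars along `f`. -/
def IsIndecomposableVia {A B : Type} [CommRing A] [CommRing B] (f : A →+* B)
    (M : Type) [AddCommGroup M] [Module B M] : Prop :=
  letI : Module A M := Module.compHom M f
  IsIndecomposableMod A M

/-- The depth of `M` as an `A`-module via restriction of scalars along `f`. -/
noncomputable def moduleDepthVia {A B : Type} [CommRing A] [IsLocalRing A] [CommRing B]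
    (f : A →+* B) (M : Type) [AddCommGroup M] [Module B M] : ℕ∞ :=
  letI : Module A M := Module.compHom M f
  moduleDepth A M

/-- `M` is maximal Cohen-Macaulay as an `A`-module via restriction of scalars along `f`. -/
def IsMCMVia {A B : Type} [CommRing A] [IsLocalRing A] [CommRing B]
    (f : A →+* B) (M : Type) [AddCommGroup M] [Module B M] : Prop :=
  letI : Module A M := Module.compHom M f
  IsMCM A M

/-- `M` and `M'` are isomorphic as `A`-modules via restriction of scalars along `f`. -/
def LinearIsoVia {A B : Type} [CommRing A] [CommRing B] (f : A →+* B)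
    (M M' : Type) [AddCommGroup M] [Module B M] [AddCommGroup M'] [Module B M'] : Prop :=
  letI : Module A M := Module.compHom M f
  letI : Module A M' := Module.compHom M' f
  Nonempty (M ≃ₗ[A] M')

section Ext

open CategoryTheory Limits

variable {C : Type*} [Category C] [Abelian C] {X Y : C}

lemma CategoryTheory.ProjectiveResolution.exactAt_linearYonedaObj_zero_iff {A : Type*} [Ring A]
    [Linear A C] (P : ProjectiveResolution X) :
    (P.complex.linearYonedaObj A Y).ExactAt 0 ↔ Subsingleton (X ⟶ Y) := by
  rw [HomologicalComplex.exactAt_iff' _ 0 0 1 (by simp) (by simp),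
    ShortComplex.moduleCat_exact_iff]
  let e : P.cokernelCofork.pt ≅ X := Iso.refl _
  rw [(e.symm.homCongr (Iso.refl Y)).subsingleton_congr]
  constructor
  · refine fun h => subsingleton_of_forall_eq 0 fun a => ?_
    refine Cofork.IsColimit.hom_ext P.isColimitCokernelCofork ?_
    obtain ⟨x : P.complex.X 0 ⟶ Y, hx⟩ := h (P.cokernelCofork.π ≫ a)
      ((CokernelCofork.condition_assoc P.cokernelCofork a).trans zero_comp)
    have hd : P.complex.d 0 0 ≫ x = P.cokernelCofork.π ≫ a := hx
    rw [← hd, P.complex.shape 0 0 (by simp), zero_comp, comp_zero]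
  · intro h (f : P.complex.X 0 ⟶ Y) (hf : P.complex.d 1 0 ≫ f = 0)
    refine ⟨0, ?_⟩
    rw [map_zero]
    obtain ⟨a, ha⟩ := CokernelCofork.IsColimit.desc' P.isColimitCokernelCofork f hf
    rw [Subsingleton.elim a 0, comp_zero] at ha
    exact ha

lemma CategoryTheory.ProjectiveResolution.exactAt_linearYonedaObj_succ_iff {A : Type*} [Ring A]
    [Linear A C] [HasExt C] (P : ProjectiveResolution X) (n : ℕ) :
    (P.complex.linearYonedaObj A Y).ExactAt (n + 1) ↔
      Subsingleton (Abelian.Ext X Y (n + 1)) := by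
  rw [HomologicalComplex.exactAt_iff' _ n (n + 1) (n + 2) (by simp) (by simp),
    ShortComplex.moduleCat_exact_iff]
  constructor
  · refine fun h => subsingleton_of_forall_eq 0 fun α => ?_
    obtain ⟨f, hf, rfl⟩ := P.extMk_surjective α (n + 2) rfl
    exact (P.extMk_eq_zero_iff f _ rfl hf n rfl).2 (h f hf)
  · intro h (f : P.complex.X (n + 1) ⟶ Y) hf
    exact (P.extMk_eq_zero_iff f _ rfl hf n rfl).1 (Subsingleton.elim _ _)

end Ext

lemma subsingleton_extGrp_iff {R : Type u} [CommRing R] (i : ℕ)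
    (M N : Type u) [AddCommGroup M] [Module R M] [AddCommGroup N] [Module R N] :
    Subsingleton (extGrp R i M N) ↔
      Subsingleton (Abelian.Ext (ModuleCat.of R M) (ModuleCat.of R N) i) := by
  rw [← ModuleCat.isZero_iff_subsingleton, extGrp,
    ((projectiveResolution (ModuleCat.of R M)).isoExt i (ModuleCat.of R N)).isZero_iff,
    ← HomologicalComplex.exactAt_iff_isZero_homology]
  cases i with
  | zero =>
    rw [ProjectiveResolution.exactAt_linearYonedaObj_zero_iff]
    exact Abelian.Ext.addEquiv₀.subsingleton_congr.symm
  | succ n => exact ProjectiveResolution.exactAt_linearYonedaObj_succ_iff _ n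

lemma natCast_le_moduleDepth_iff {R : Type u} [CommRing R] [IsLocalRing R] {M : Type u}
    [AddCommGroup M] [Module R M] {n : ℕ} :
    (n : ℕ∞) ≤ moduleDepth R M ↔
      ∀ i < n, Subsingleton (extGrp R i (ResidueField R) M) := by
  simp only [moduleDepth, le_sInf_iff, Set.mem_ofPred_eq]
  constructor
  · intro h i hi
    by_contra hc
    exact absurd (h i ⟨i, rfl, hc⟩) (by simpa using hi)
  · rintro h _ ⟨i, rfl, hi⟩
    by_contra hc
    exact hi (h i (by simpa using hc))

lemma natCast_le_moduleDepth_iff_exists_isRegular {R : Type u} [CommRing R] [IsLocalRing R]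
    [IsNoetherianRing R] {M : Type u} [AddCommGroup M] [Module R M] [Module.Finite R M]
    [Nontrivial M] {n : ℕ} :
    (n : ℕ∞) ≤ moduleDepth R M ↔ ∃ rs : List R, rs.length = n ∧
      (∀ r ∈ rs, r ∈ maximalIdeal R) ∧ RingTheory.Sequence.IsRegular M rs := by
  have hlt : maximalIdeal R • (⊤ : Submodule R M) < ⊤ :=
    lt_top_iff_ne_top.2 (Submodule.top_ne_ideal_smul_of_le_jacobson_annihilator
      (IsLocalRing.maximalIdeal_le_jacobson _)).symm
  have hfin : Module.Finite R (ResidueField R) := Module.Finite.quotient R (maximalIdeal R)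
  have hsupp : Module.support R (ResidueField R) =
      PrimeSpectrum.zeroLocus (maximalIdeal R : Set R) := by
    rw [Module.support_eq_zeroLocus]
    congr 2
    exact Ideal.annihilator_quotient
  simp only [natCast_le_moduleDepth_iff, subsingleton_extGrp_iff]
  constructor
  · exact ModuleCat.exists_isRegular_of_exists_subsingleton_ext _ n (ModuleCat.of R M) hlt
      (ModuleCat.of R (ResidueField R)) hsupp
  · rintro ⟨rs, rfl, hrs, h⟩
    exact ModuleCat.subsingleton_ext_of_exists_isRegular _ (ModuleCat.of R (ResidueField R))
      hsupp.subset (ModuleCat.of R M) hlt rs hrs h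

section Surjective

variable {R S : Type u} [CommRing R] [CommRing S] [Algebra R S]

/-- Along a surjective ring homomorphism, restriction of scalars does not change the lattice of
submodules. -/
noncomputable def Submodule.restrictScalarsOrderIso (hf : Function.Surjective (algebraMap R S))
    (M : Type*) [AddCommGroup M] [Module R M] [Module S M] [IsScalarTower R S M] :
    Submodule S M ≃o Submodule R M :=
  RelIso.ofSurjective (Submodule.restrictScalarsEmbedding R S M) fun N =>
    ⟨{ N with
        smul_mem' := fun c x hx => by
          obtain ⟨r, rfl⟩ := hf c
          rw [algebraMap_smul]
          exact N.smul_mem r hx }, rfl⟩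

lemma isNoetherian_of_surjective_algebraMap (hf : Function.Surjective (algebraMap R S))
    (M : Type*) [AddCommGroup M] [Module R M] [Module S M] [IsScalarTower R S M]
    [h : IsNoetherian S M] : IsNoetherian R M := by
  rw [isNoetherian_iff'] at h ⊢
  exact (Submodule.restrictScalarsOrderIso hf M).symm.toOrderEmbedding.wellFoundedGT

lemma isIndecomposableMod_of_surjective (hf : Function.Surjective (algebraMap R S)) {M : Type u}
    [AddCommGroup M] [Module R M] [Module S M] [IsScalarTower R S M]
    (h : IsIndecomposableMod S M) : IsIndecomposableMod R M := by
  let e := Submodule.restrictScalarsOrderIso hf M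
  refine ⟨h.1, fun N₁ N₂ hN => ?_⟩
  simpa using h.2 (e.symm N₁) (e.symm N₂) (e.symm.isCompl hN)

lemma RingTheory.Sequence.isRegular_map_algebraMap_iff_of_mem_maximalIdeal [IsLocalRing R]
    [IsLocalRing S] [IsLocalHom (algebraMap R S)] (M : Type*) [AddCommGroup M] [Module R M]
    [Module S M] [IsScalarTower R S M] [Nontrivial M] [Module.Finite R M] [Module.Finite S M]
    {rs : List R} (h : ∀ r ∈ rs, r ∈ maximalIdeal R) :
    IsRegular M (rs.map (algebraMap R S)) ↔ IsRegular M rs := by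
  rw [IsLocalRing.isRegular_iff_isWeaklyRegular_of_subset_maximalIdeal h,
    IsLocalRing.isRegular_iff_isWeaklyRegular_of_subset_maximalIdeal (by simpa using h),
    isWeaklyRegular_map_algebraMap_iff]

lemma moduleDepth_eq_of_surjective (hf : Function.Surjective (algebraMap R S))
    [IsLocalRing R] [IsLocalRing S] [IsNoetherianRing R] [IsNoetherianRing S] (M : Type u)
    [AddCommGroup M] [Module R M] [Module S M] [IsScalarTower R S M] [Module.Finite S M]
    [Nontrivial M] : moduleDepth R M = moduleDepth S M := by
  have : Module.Finite R S := Module.Finite.of_surjective (Algebra.linearMap R S) hf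
  have : Module.Finite R M := Module.Finite.trans S M
  have : IsLocalHom (algebraMap R S) := IsLocalHom.of_surjective _ hf
  refine ENat.eq_of_forall_natCast_le_iff fun n => ?_
  rw [natCast_le_moduleDepth_iff_exists_isRegular, natCast_le_moduleDepth_iff_exists_isRegular]
  constructor
  · rintro ⟨rs, hlen, hmem, hreg⟩
    exact ⟨rs.map (algebraMap R S), by simpa, by simpa using hmem,
      (RingTheory.Sequence.isRegular_map_algebraMap_iff_of_mem_maximalIdeal M hmem).2 hreg⟩
  · rintro ⟨rs, hlen, hmem, hreg⟩
    obtain ⟨rs, rfl⟩ := List.map_surjective_iff.2 hf rs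
    have hmem' : ∀ r ∈ rs, r ∈ maximalIdeal R := by simpa using hmem
    exact ⟨rs, by simpa using hlen, hmem',
      (RingTheory.Sequence.isRegular_map_algebraMap_iff_of_mem_maximalIdeal M hmem').1 hreg⟩

lemma isMCM_of_surjective (hf : Function.Surjective (algebraMap R S))
    [IsLocalRing R] [IsLocalRing S] [IsNoetherianRing R] [IsNoetherianRing S]
    (hdim : ringKrullDim R = ringKrullDim S) {M : Type u}
    [AddCommGroup M] [Module R M] [Module S M] [IsScalarTower R S M] [Nontrivial M]
    (h : IsMCM S M) : IsMCM R M := by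
  have := h.1
  have : Module.Finite R S := Module.Finite.of_surjective (Algebra.linearMap R S) hf
  exact ⟨Module.Finite.trans S M, by rw [moduleDepth_eq_of_surjective hf M, h.2, hdim]⟩

/-- Finite Cohen-Macaulay type descends to quotient rings of the same dimension. -/
lemma HasFiniteCMType.of_surjective [IsLocalRing R] [IsLocalRing S] [IsNoetherianRing R]
    [IsNoetherianRing S] (hf : Function.Surjective (algebraMap R S))
    (hdim : ringKrullDim R = ringKrullDim S) (h : HasFiniteCMType R) : HasFiniteCMType S := by
  classical
  obtain ⟨L, hL⟩ := h
  let F := ModuleCat.restrictScalars.{u} (algebraMap R S)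
  let lift (N : ModuleCat.{u} R) : ModuleCat.{u} S :=
    if hN : ∃ M, Nonempty (F.obj M ≅ N) then hN.choose else ModuleCat.of S PUnit
  refine ⟨L.map lift, fun M hM hind => ?_⟩
  let : Module R M := Module.compHom M (algebraMap R S)
  have : IsScalarTower R S M := .of_algebraMap_smul fun _ _ => rfl
  have : Nontrivial M := not_subsingleton_iff_nontrivial.1 hind.1
  have hMCM : IsMCM R M := isMCM_of_surjective hf hdim hM
  have hind' : IsIndecomposableMod R M := isIndecomposableMod_of_surjective hf hind
  obtain ⟨N, hNL, ⟨e⟩⟩ := hL (F.obj M) hMCM hind'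
  have hN : ∃ M, Nonempty (F.obj M ≅ N) := ⟨M, ⟨e⟩⟩
  refine ⟨lift N, List.mem_map_of_mem hNL, ?_⟩
  obtain ⟨e'⟩ := hN.choose_spec
  let E := (e ≪≫ e'.symm).toLinearEquiv
  have hE : lift N = hN.choose := dif_pos hN
  rw [hE]
  let E' : M ≃ₗ[S] hN.choose :=
    { toFun := E
      invFun := E.symm
      left_inv := E.left_inv
      right_inv := E.right_inv
      map_add' := E.map_add
      map_smul' := fun s x => by
        obtain ⟨r, rfl⟩ := hf s
        exact E.map_smul r x }
  exact ⟨E'.toModuleIso⟩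

end Surjective

section KrullDim

variable {R S T : Type*} [CommRing R] [CommRing S] [CommRing T]

lemma LTSeries.length_le_ringKrullDim_of_ker_le {f : R →+* S} (hf : Function.Surjective f)
    (l : LTSeries (PrimeSpectrum R)) (hl : RingHom.ker f ≤ l.head.asIdeal) :
    (l.length : WithBot ℕ∞) ≤ ringKrullDim S := by
  rw [← ringKrullDim_eq_of_ringEquiv (RingHom.quotientKerEquivOfSurjective hf),
    ringKrullDim_quotient]
  let l' : LTSeries (PrimeSpectrum.zeroLocus (RingHom.ker f : Set R)) :=
    ⟨l.length, fun i => ⟨l i, hl.trans (l.head_le i)⟩, fun i => l.step i⟩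
  exact Order.LTSeries.length_le_krullDim l'

lemma ringKrullDim_le_max_of_ker_inf_ker_eq_bot {f : R →+* S} {g : R →+* T}
    (hf : Function.Surjective f) (hg : Function.Surjective g)
    (h : RingHom.ker f ⊓ RingHom.ker g = ⊥) :
    ringKrullDim R ≤ max (ringKrullDim S) (ringKrullDim T) := by
  refine iSup_le fun l => le_max_iff.2 ?_
  exact (l.head.isPrime.inf_le.1 (h.le.trans bot_le)).imp
    (l.length_le_ringKrullDim_of_ker_le hf) (l.length_le_ringKrullDim_of_ker_le hg)

end KrullDim

lemma IsNoetherianRing.of_ker_inf_ker_eq_bot {R S T : Type u} [CommRing R] [CommRing S]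
    [CommRing T] [IsNoetherianRing S] [IsNoetherianRing T] {f : R →+* S} {g : R →+* T}
    (hf : Function.Surjective f) (hg : Function.Surjective g)
    (h : RingHom.ker f ⊓ RingHom.ker g = ⊥) : IsNoetherianRing R := by
  algebraize [f, g]
  have : IsNoetherian R S := isNoetherian_of_surjective_algebraMap hf S
  have : IsNoetherian R T := isNoetherian_of_surjective_algebraMap hg T
  refine isNoetherian_of_injective ((Algebra.linearMap R S).prod (Algebra.linearMap R T)) ?_
  rw [← LinearMap.ker_eq_bot, LinearMap.ker_prod]
  exact h

section FiberProduct

variable {k S T : Type u} [CommRing k] [CommRing S] [CommRing T] {πS : S →+* k} {πT : T →+* k}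

lemma fiberProduct_fst_surjective (hπT : Function.Surjective πT) :
    Function.Surjective ((RingHom.fst S T).comp (fiberProduct πS πT).subtype) := fun s =>
  let ⟨t, ht⟩ := hπT (πS s)
  ⟨⟨(s, t), ht.symm⟩, rfl⟩

lemma fiberProduct_snd_surjective (hπS : Function.Surjective πS) :
    Function.Surjective ((RingHom.snd S T).comp (fiberProduct πS πT).subtype) := fun t =>
  let ⟨s, hs⟩ := hπS (πT t)
  ⟨⟨(s, t), hs⟩, rfl⟩

variable (πS πT) in
lemma fiberProduct_ker_fst_inf_ker_snd :
    RingHom.ker ((RingHom.fst S T).comp (fiberProduct πS πT).subtype) ⊓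
      RingHom.ker ((RingHom.snd S T).comp (fiberProduct πS πT).subtype) = ⊥ :=
  le_bot_iff.1 fun _ hx => Subtype.ext (Prod.ext hx.1 hx.2)

end FiberProduct

/-- Proposition: if `dim S ≥ dim T` and the non-trivial fiber product `R = S ×_k T` has
finite Cohen-Macaulay type, then `S` has finite Cohen-Macaulay type. -/
theorem finiteCMType_of_fiberProduct
    (k S T : Type) [Field k] [CommRing S] [IsNoetherianRing S] [IsLocalRing S]
    [CommRing T] [IsNoetherianRing T] [IsLocalRing T]
    (πS : S →+* k) (πT : T →+* k)
    (hπS : IsResidueSurjection πS) (hπT : IsResidueSurjection πT)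
    (hSnt : IsLocalRing.maximalIdeal S ≠ ⊥) (hTnt : IsLocalRing.maximalIdeal T ≠ ⊥)
    [IsLocalRing ↥(fiberProduct πS πT)]
    (hdim : ringKrullDim T ≤ ringKrullDim S)
    (hfin : HasFiniteCMType ↥(fiberProduct πS πT)) :
    HasFiniteCMType S := by
  have hf := fiberProduct_fst_surjective (πS := πS) hπT.1
  have hg := fiberProduct_snd_surjective (πT := πT) hπS.1
  have hker := fiberProduct_ker_fst_inf_ker_snd πS πT
  have := IsNoetherianRing.of_ker_inf_ker_eq_bot hf hg hker
  let := ((RingHom.fst S T).comp (fiberProduct πS πT).subtype).toAlgebra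
  refine HasFiniteCMType.of_surjective hf (le_antisymm ?_ ?_) hfin
  · exact (ringKrullDim_le_max_of_ker_inf_ker_eq_bot hf hg hker).trans (max_le le_rfl hdim)
  · exact ringKrullDim_le_of_surjective _ hf
end

section
/- Let (R, m_R) be a local ring whose maximal ideal m_R is not principal. If there exists an element z in the socle Soc(R) with z ∈ m_R but z ∉ m_R², then m_R is decomposable; in fact the cyclic submodule Rz, which is isomorphic to the residue field k, is a direct summand of m_R. -/
/-! Common definitions for formalizing Nasseh–Sather-Wagstaff–Takahashi–VandeBogert,
"Applications and homological properties of local rings with decomposable maximal ideals". -/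

open CategoryTheory IsLocalRing

/-- An element annihilated by the maximal ideal generates an ideal that meets trivially every
ideal not containing it. -/
theorem span_singleton_inf_eq_bot_of_mul_maximalIdeal_eq_zero {R : Type*} [CommRing R]
    [IsLocalRing R] {z : R} (hz : ∀ x ∈ maximalIdeal R, z * x = 0) {J : Ideal R} (hJ : z ∉ J) :
    Ideal.span {z} ⊓ J = ⊥ := by
  rw [eq_bot_iff]
  rintro x ⟨hx, hxJ⟩
  obtain ⟨r, rfl⟩ := Ideal.mem_span_singleton'.mp hx
  by_cases hr : IsUnit r
  · exact absurd ((Ideal.unit_mul_mem_iff_mem J hr).mp hxJ) hJ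
  · rw [mul_comm, hz r ((mem_maximalIdeal r).mpr hr)]
    exact zero_mem _

/-- In a noetherian local ring, a minimal generator of the maximal ideal has a complementary
generating ideal omitting it. -/
theorem exists_span_singleton_sup_eq_maximalIdeal {R : Type*} [CommRing R] [IsNoetherianRing R]
    [IsLocalRing R] {z : R} (hz1 : z ∈ maximalIdeal R) (hz2 : z ∉ maximalIdeal R ^ 2) :
    ∃ J : Ideal R, z ∉ J ∧ Ideal.span {z} ⊔ J = maximalIdeal R := by
  let S : Set (Ideal R) := {J | maximalIdeal R ^ 2 ≤ J ∧ J ≤ maximalIdeal R ∧ z ∉ J}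
  have hS : S.Nonempty := ⟨maximalIdeal R ^ 2, le_rfl, Ideal.pow_le_self two_ne_zero, hz2⟩
  obtain ⟨J, ⟨hsq, hle, hzJ⟩, hmax⟩ := set_has_maximal_iff_noetherian.mpr ‹_› S hS
  refine ⟨J, hzJ, le_antisymm (sup_le ((Ideal.span_singleton_le_iff_mem _).mpr hz1) hle) ?_⟩
  intro x hx
  by_cases hxJ : x ∈ J
  · exact Ideal.mem_sup_right hxJ
  have hzx : z ∈ Ideal.span {x} ⊔ J := by
    by_contra hzx
    refine hmax (Ideal.span {x} ⊔ J) ⟨hsq.trans le_sup_right,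
      sup_le ((Ideal.span_singleton_le_iff_mem _).mpr hx) hle, hzx⟩ ?_
    exact lt_of_le_of_ne le_sup_right fun h =>
      hxJ (h ▸ Ideal.mem_sup_left (Ideal.mem_span_singleton_self x))
  obtain ⟨r, j, hj, hrj⟩ := Ideal.mem_span_singleton_sup.mp hzx
  by_cases hr : IsUnit r
  · rw [← Ideal.unit_mul_mem_iff_mem _ hr, eq_sub_of_add_eq hrj]
    exact sub_mem (Ideal.mem_sup_left (Ideal.mem_span_singleton_self z)) (Ideal.mem_sup_right hj)
  · refine absurd (hrj ▸ add_mem (hsq ?_) hj) hzJ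
    rw [pow_two]
    exact Ideal.mul_mem_mul ((mem_maximalIdeal r).mpr hr) hx

/-- A nonzero element annihilated by the maximal ideal spans a copy of the residue field. -/
theorem nonempty_span_singleton_equiv_residueField {R : Type*} [CommRing R] [IsLocalRing R]
    {z : R} (hz : ∀ x ∈ maximalIdeal R, z * x = 0) (hz0 : z ≠ 0) :
    Nonempty (Ideal.span {z} ≃ₗ[R] ResidueField R) := by
  have h : Ideal.torsionOf R R z = maximalIdeal R := by
    refine le_antisymm (le_maximalIdeal ?_) fun x hx => ?_
    · rwa [Ne, Ideal.eq_top_iff_one, Ideal.mem_torsionOf_iff, one_smul]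
    · rw [Ideal.mem_torsionOf_iff, smul_eq_mul, mul_comm, hz x hx]
  exact ⟨(Ideal.quotTorsionOfEquivSpanSingleton R R z).symm.trans (Submodule.quotEquivOfEq _ _ h)⟩

/-- Claim: if the maximal ideal of `R` is not principal and some socle element `z` lies
in `m_R` but not in `m_R²`, then `m_R` is decomposable; in fact `Rz ≅ k` is a direct
summand of `m_R`. -/
theorem decomposable_of_socle_element
    (R : Type) [CommRing R] [IsNoetherianRing R] [IsLocalRing R]
    (hnp : ¬ (IsLocalRing.maximalIdeal R).IsPrincipal)
    (z : R) (hzsoc : ∀ x ∈ IsLocalRing.maximalIdeal R, z * x = 0)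
    (hz1 : z ∈ IsLocalRing.maximalIdeal R)
    (hz2 : z ∉ IsLocalRing.maximalIdeal R ^ 2) :
    HasDecomposableMaxIdeal R ∧
    Nonempty (↥(Ideal.span {z}) ≃ₗ[R] IsLocalRing.ResidueField R) ∧
    ∃ J : Ideal R, Ideal.span {z} ⊓ J = ⊥ ∧ Ideal.span {z} ⊔ J = IsLocalRing.maximalIdeal R := by
  have hz0 : z ≠ 0 := fun h => hz2 (h ▸ zero_mem _)
  obtain ⟨J, hzJ, hsup⟩ := exists_span_singleton_sup_eq_maximalIdeal hz1 hz2
  have hinf := span_singleton_inf_eq_bot_of_mul_maximalIdeal_eq_zero hzsoc hzJ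
  refine ⟨⟨Ideal.span {z}, J, ?_, ?_, hinf, hsup⟩,
    nonempty_span_singleton_equiv_residueField hzsoc hz0, J, hinf, hsup⟩
  · rwa [Ne, Ideal.span_singleton_eq_bot]
  · rintro rfl
    exact hnp ⟨z, by rw [← hsup, sup_bot_eq, Ideal.submodule_span_eq]⟩
end
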